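/- Let A be a reduced commutative Noetherian ring and F ∈ P_A such that Apolar(F) is finitely generated as an A-module. If the length dim_{κ(t)} Apolar(F_t) is the same for every prime t of A, then P_A/(S_A·F) is a flat A-module, i.e., the apolar family Spec Apolar(F) → Spec A is flatly embedded. -/

import Mathlib

noncomputable section

open MvPolynomial

namespace RelativeApolarity

variable {A : Type*} [CommRing A] {n : ℕ}

/-- The precomposition action of `σ ∈ S_A` on `f ∈ P_A = Hom_A(S_A, A)`:
`(σ·f)(τ) = f(στ)`. -/
def pact (σ : MvPolynomial (Fin n) A) (f : Module.Dual A (MvPolynomial (Fin n) A)) :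
    Module.Dual A (MvPolynomial (Fin n) A) :=
  f ∘ₗ LinearMap.mulLeft A σ

lemma pact_apply (σ τ : MvPolynomial (Fin n) A) (f : Module.Dual A (MvPolynomial (Fin n) A)) :
    pact σ f τ = f (σ * τ) := rfl

lemma pact_zero (f : Module.Dual A (MvPolynomial (Fin n) A)) : pact 0 f = 0 := by
  apply LinearMap.ext; intro ρ
  show f (0 * ρ) = 0
  rw [zero_mul, map_zero]

lemma pact_add (σ τ : MvPolynomial (Fin n) A) (f : Module.Dual A (MvPolynomial (Fin n) A)) :
    pact (σ + τ) f = pact σ f + pact τ f := by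
  apply LinearMap.ext; intro ρ
  show f ((σ + τ) * ρ) = f (σ * ρ) + f (τ * ρ)
  rw [add_mul, map_add]

lemma pact_smul (a : A) (σ : MvPolynomial (Fin n) A)
    (f : Module.Dual A (MvPolynomial (Fin n) A)) :
    pact (a • σ) f = a • pact σ f := by
  apply LinearMap.ext; intro ρ
  show f ((a • σ) * ρ) = a • f (σ * ρ)
  rw [smul_mul_assoc, map_smul]

lemma pact_mul (σ τ : MvPolynomial (Fin n) A) (f : Module.Dual A (MvPolynomial (Fin n) A)) :
    pact (σ * τ) f = pact σ (pact τ f) := by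
  apply LinearMap.ext; intro ρ
  show f (σ * τ * ρ) = f (τ * (σ * ρ))
  exact congrArg f (by ring)

/-- The apolar ideal `Ann(F) = {σ ∈ S_A : σ·F = 0}`. -/
def annRel (F : Module.Dual A (MvPolynomial (Fin n) A)) : Ideal (MvPolynomial (Fin n) A) where
  carrier := {σ | pact σ F = 0}
  zero_mem' := pact_zero F
  add_mem' := by
    intro a b ha hb
    show pact (a + b) F = 0
    rw [pact_add, ha, hb, add_zero]
  smul_mem' := by
    intro c x hx
    show pact (c • x) F = 0
    rw [smul_eq_mul, pact_mul, hx]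
    show (0 : Module.Dual A (MvPolynomial (Fin n) A)) ∘ₗ _ = 0
    exact LinearMap.zero_comp _

/-- The `A`-linear map `σ ↦ σ·F`. -/
def actMap (F : Module.Dual A (MvPolynomial (Fin n) A)) :
    MvPolynomial (Fin n) A →ₗ[A] Module.Dual A (MvPolynomial (Fin n) A) where
  toFun σ := pact σ F
  map_add' σ τ := pact_add σ τ F
  map_smul' a σ := pact_smul a σ F

/-- The `A`-submodule `S_A·F ⊆ P_A`. -/
def SAF (F : Module.Dual A (MvPolynomial (Fin n) A)) :
    Submodule A (Module.Dual A (MvPolynomial (Fin n) A)) :=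
  LinearMap.range (actMap F)

/-- The embedding `A[x₁,…,xₙ] ↪ P_A` sending the monomial `x^b` to the functional taking
`α^a` to `1` if `a = b` and to `0` otherwise. -/
def polyToDual : MvPolynomial (Fin n) A →ₗ[A] Module.Dual A (MvPolynomial (Fin n) A) :=
  (MvPolynomial.basisMonomials (Fin n) A).toDual

/-- Base change `P_A → P_B` of functionals: `F_B` is the `B`-linear extension of
`φ ∘ F`, i.e. the functional with `F_B(α^m) = φ(F(α^m))`. -/
def dualBC (B : Type*) [CommRing B] [Algebra A B] :
    Module.Dual A (MvPolynomial (Fin n) A) →ₗ[A] Module.Dual B (MvPolynomial (Fin n) B) :=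
  ((((MvPolynomial.basisMonomials (Fin n) B).constr A).toLinearMap).comp
    ((LinearMap.compLeft (Algebra.linearMap A B) ((Fin n) →₀ ℕ)).comp
      (LinearMap.pi fun m : (Fin n) →₀ ℕ =>
        LinearMap.applyₗ (MvPolynomial.monomial m (1 : A)))))

/-- The residue field `κ(p)` of a prime `p`. -/
def resField {A : Type*} [CommRing A] (p : PrimeSpectrum A) : Type _ :=
  IsLocalRing.ResidueField (Localization.AtPrime p.asIdeal)

noncomputable instance {A : Type*} [CommRing A] (p : PrimeSpectrum A) :
    Field (resField p) :=
  inferInstanceAs (Field (IsLocalRing.ResidueField (Localization.AtPrime p.asIdeal)))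

/-- The canonical map `A → κ(p)` as an algebra structure. -/
noncomputable instance {A : Type*} [CommRing A] (p : PrimeSpectrum A) :
    Algebra A (resField p) :=
  ((algebraMap (Localization.AtPrime p.asIdeal)
      (IsLocalRing.ResidueField (Localization.AtPrime p.asIdeal))).comp
    (algebraMap A (Localization.AtPrime p.asIdeal))).toAlgebra

universe u

open TensorProduct in
lemma flat_pi_self (A : Type*) [CommRing A] [IsNoetherianRing A] (ι : Type*) :
    Module.Flat A (ι → A) := by
  rw [Module.Flat.iff_forall_isTrivialRelation]
  intro l f x h
  let g : (Fin l → A) →ₗ[A] A := Fintype.linearCombination A f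
  obtain ⟨k, y, hy⟩ := Submodule.fg_iff_exists_fin_generating_family.mp
    (IsNoetherian.noetherian (LinearMap.ker g))
  have hx : ∀ t : ι, ∃ c : Fin k → A, ∑ j, c j • y j = fun i => x i t := by
    intro t
    rw [← Submodule.mem_span_range_iff_exists_fun, hy, LinearMap.mem_ker]
    have := congrFun h t
    simpa [g, Fintype.linearCombination_apply, mul_comm] using this
  choose c hc using hx
  refine ⟨k, fun i j => y j i, fun j t => c t j, fun i => ?_, fun j => ?_⟩
  · funext t
    have := congrFun (hc t) i
    simp [← this, mul_comm]
  · have : y j ∈ LinearMap.ker g := hy ▸ Submodule.subset_span ⟨j, rfl⟩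
    simpa [g, Fintype.linearCombination_apply, mul_comm] using this

open TensorProduct in
lemma free_of_local {R : Type*} [CommRing R] [IsReduced R] [IsLocalRing R]
    (C : Type*) [AddCommGroup C] [Module R C] [Module.Finite R C] (e : ℕ)
    (h : ∀ q : PrimeSpectrum R,
      Module.finrank q.asIdeal.ResidueField (q.asIdeal.ResidueField ⊗[R] C) = e)
    (h0 : Module.finrank (IsLocalRing.ResidueField R) (IsLocalRing.ResidueField R ⊗[R] C) = e) :
    Module.Free R C := by
  let b := Module.finBasisOfFinrankEq _ _ h0
  have hs : ∀ i, ∃ x : C, (1 : IsLocalRing.ResidueField R) ⊗ₜ[R] x = b i := fun i =>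
    TensorProduct.mk_surjective R C _ Ideal.Quotient.mk_surjective (b i)
  choose v hv using hs
  have hspan := IsLocalRing.span_eq_top_of_tmul_eq_basis v b hv
  let g : (Fin e → R) →ₗ[R] C := Fintype.linearCombination R v
  have hg : Function.Surjective g := by
    rw [← LinearMap.range_eq_top, Fintype.range_linearCombination, hspan]
  have hinj : Function.Injective g := by
    rw [injective_iff_map_eq_zero]
    intro x hx
    funext i
    have hnil : IsNilpotent (x i) := by
      rw [nilpotent_iff_mem_prime]
      intro q hq
      let K := q.ResidueField
      let gK := (g.baseChange K)
      have hgK : Function.Surjective gK := LinearMap.lTensor_surjective K hg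
      have hd : Module.finrank K (K ⊗[R] (Fin e → R)) = Module.finrank K (K ⊗[R] C) := by
        rw [h ⟨q, hq⟩]
        rw [(TensorProduct.piScalarRight R K K (Fin e)).finrank_eq]
        simp
      have hgi : Function.Injective gK :=
        (LinearMap.injective_iff_surjective_of_finrank_eq_finrank hd).mpr hgK
      have h1 : (1 : K) ⊗ₜ[R] x = 0 := by
        apply hgi
        simp [gK, hx]
      have h2 := congrFun (congrArg (TensorProduct.piScalarRight R K K (Fin e)) h1) i
      simp [Algebra.smul_def] at h2
      exact Ideal.algebraMap_residueField_eq_zero.mp h2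
    exact hnil.eq_zero
  exact Module.Free.of_equiv (LinearEquiv.ofBijective g ⟨hinj, hg⟩)

open TensorProduct in
lemma projective_of_const {A : Type u} [CommRing A] [IsReduced A] [IsNoetherianRing A]
    (C : Type*) [AddCommGroup C] [Module A C] [Module.Finite A C] (e : ℕ)
    (h : ∀ (K : Type u) [Field K] [Algebra A K], Module.finrank K (K ⊗[A] C) = e) :
    Module.Projective A C := by
  have : Module.FinitePresentation A C := Module.finitePresentation_of_finite A C
  rw [← Module.freeLocus_eq_univ_iff, Set.eq_univ_iff_forall]
  intro p
  let R := Localization.AtPrime p.asIdeal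
  rw [Module.mem_freeLocus_iff_tensor p R]
  have key : ∀ (K : Type u) [Field K] [Algebra R K],
      Module.finrank K (K ⊗[R] (R ⊗[A] C)) = e := by
    intro K _ _
    let _ : Algebra A K := ((algebraMap R K).comp (algebraMap A R)).toAlgebra
    have : IsScalarTower A R K := .of_algebraMap_eq' rfl
    rw [(TensorProduct.AlgebraTensorModule.cancelBaseChange A R K K C).finrank_eq, h K]
  have : IsReduced R := inferInstance
  exact free_of_local _ e (fun q => key _) (key _)

open TensorProduct in
lemma finrank_of_resField {A : Type u} [CommRing A]
    (C : Type*) [AddCommGroup C] [Module A C] (e : ℕ)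
    (h : ∀ p : PrimeSpectrum A, Module.finrank (resField p) (resField p ⊗[A] C) = e)
    (K : Type u) [Field K] [Algebra A K] : Module.finrank K (K ⊗[A] C) = e := by
  let p : PrimeSpectrum A := ⟨RingHom.ker (algebraMap A K), RingHom.ker_isPrime _⟩
  have hp : p.asIdeal.IsPrime := p.isPrime
  let φ : resField p →+* K := Ideal.ResidueField.lift p.asIdeal (algebraMap A K) le_rfl (by
    intro x hx
    exact isUnit_iff_ne_zero.mpr hx)
  have hφ : ∀ a, φ (algebraMap A (resField p) a) = algebraMap A K a := fun a =>
    Ideal.ResidueField.lift_algebraMap p.asIdeal (algebraMap A K) _ _ a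
  let _ : Algebra (resField p) K := φ.toAlgebra
  have : IsScalarTower A (resField p) K := .of_algebraMap_eq fun a => (hφ a).symm
  rw [← h p, ← Module.finrank_baseChange (R := K) (S := resField p),
    (TensorProduct.AlgebraTensorModule.cancelBaseChange A (resField p) K K C).finrank_eq]

lemma dualBC_map {A : Type*} [CommRing A] {n : ℕ} (B : Type*) [CommRing B] [Algebra A B]
    (F : Module.Dual A (MvPolynomial (Fin n) A)) (σ : MvPolynomial (Fin n) A) :
    dualBC B F (MvPolynomial.map (algebraMap A B) σ) = algebraMap A B (F σ) := by
  have key : (dualBC B F).restrictScalars A ∘ₗ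
      (MvPolynomial.mapAlgHom (Algebra.ofId A B)).toLinearMap =
      (Algebra.linearMap A B) ∘ₗ F := by
    apply (MvPolynomial.basisMonomials (Fin n) A).ext
    intro m
    have h1 : (MvPolynomial.mapAlgHom (Algebra.ofId A B))
        (MvPolynomial.basisMonomials (Fin n) A m) = MvPolynomial.basisMonomials (Fin n) B m := by
      rw [MvPolynomial.coe_basisMonomials, MvPolynomial.coe_basisMonomials]
      change MvPolynomial.map (algebraMap A B) (monomial m 1) = monomial m 1
      rw [MvPolynomial.map_monomial, map_one]
    have h2 : dualBC B F (MvPolynomial.basisMonomials (Fin n) B m) =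
        algebraMap A B (F (monomial m 1)) := by
      rw [dualBC, LinearMap.comp_apply]
      exact (MvPolynomial.basisMonomials (Fin n) B).constr_basis A _ m
    rw [LinearMap.comp_apply, AlgHom.toLinearMap_apply]
    rw [h1, LinearMap.restrictScalars_apply, h2]
    simp
  exact LinearMap.congr_fun key σ


open TensorProduct in
/-- The evaluation of functionals at a finite family. -/
def evalFam {A : Type*} [CommRing A] {n r : ℕ} (s : Fin r → MvPolynomial (Fin n) A) :
    Module.Dual A (MvPolynomial (Fin n) A) →ₗ[A] (Fin r → A) :=
  LinearMap.pi fun i => LinearMap.applyₗ (s i)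

lemma mem_annRel {A : Type*} [CommRing A] {n : ℕ} (F : Module.Dual A (MvPolynomial (Fin n) A))
    (σ : MvPolynomial (Fin n) A) : σ ∈ annRel F ↔ ∀ τ, F (σ * τ) = 0 := by
  change pact σ F = 0 ↔ _
  rw [LinearMap.ext_iff]
  rfl

open TensorProduct in
lemma finrank_coker {A : Type*} [CommRing A] {n r : ℕ}
    (F : Module.Dual A (MvPolynomial (Fin n) A)) (s : Fin r → MvPolynomial (Fin n) A)
    (hs : ∀ τ, ∃ c : Fin r → A, τ - ∑ i, c i • s i ∈ annRel F)
    (K : Type*) [Field K] [Algebra A K] :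
    Module.finrank K (K ⊗[A] ((Fin r → A) ⧸ LinearMap.range (evalFam s ∘ₗ actMap F))) =
      r - Module.finrank K (MvPolynomial (Fin n) K ⧸ annRel (dualBC K F)) := by
  set φ := evalFam s ∘ₗ actMap F with hφ
  let e := MvPolynomial.algebraTensorAlgEquiv (σ := Fin n) A K
  let φK := φ.baseChange K
  let G := dualBC K F
  let mp := MvPolynomial.map (σ := Fin n) (algebraMap A K)
  have hcomm : ∀ x i, TensorProduct.piScalarRight A K K (Fin r) (φK x) i = G (e x * mp (s i)) := by
    intro x i
    induction x with
    | zero => simp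
    | add x y hx hy => simp only [map_add, Pi.add_apply, hx, hy, add_mul]
    | tmul a σ =>
      have h1 : e (a ⊗ₜ σ) = a • mp σ := MvPolynomial.algebraTensorAlgEquiv_tmul A K a σ
      have h2 : G (mp (σ * s i)) = algebraMap A K (F (σ * s i)) := dualBC_map K F _
      rw [h1, smul_mul_assoc, ← map_mul, map_smul, h2]
      have h3 : φ σ i = F (σ * s i) := rfl
      simp [φK, h3, Algebra.smul_def, mul_comm]
  have hann : ∀ τ ∈ annRel F, mp τ ∈ annRel G := by
    intro τ hτ
    rw [mem_annRel] at hτ ⊢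
    intro ρ
    obtain ⟨x, rfl⟩ := e.surjective ρ
    induction x with
    | zero => simp
    | add x y hx hy => rw [map_add, mul_add, map_add, hx, hy, add_zero]
    | tmul a σ =>
      have h1 : e (a ⊗ₜ σ) = a • mp σ := MvPolynomial.algebraTensorAlgEquiv_tmul A K a σ
      have h2 : G (mp (τ * σ)) = algebraMap A K (F (τ * σ)) := dualBC_map K F _
      rw [h1, mul_smul_comm, ← map_mul, map_smul, h2, hτ, map_zero, smul_zero]
  have hker : ∀ x, φK x = 0 ↔ e x ∈ annRel G := by
    intro x
    constructor
    · intro hx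
      have hx' : ∀ i, G (e x * mp (s i)) = 0 := fun i => by rw [← hcomm, hx]; simp
      rw [mem_annRel]
      intro ρ
      obtain ⟨y, rfl⟩ := e.surjective ρ
      induction y with
      | zero => simp
      | add x y hx hy => rw [map_add, mul_add, map_add, hx, hy, add_zero]
      | tmul a σ =>
        have h1 : e (a ⊗ₜ σ) = a • mp σ := MvPolynomial.algebraTensorAlgEquiv_tmul A K a σ
        obtain ⟨c, hc⟩ := hs σ
        have h3 := (mem_annRel _ _).mp (hann _ hc) (e x)
        have h4 : mp (∑ i, c i • s i) = ∑ i, algebraMap A K (c i) • mp (s i) := by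
          rw [map_sum]
          refine Finset.sum_congr rfl fun i _ => ?_
          rw [MvPolynomial.smul_eq_C_mul, MvPolynomial.smul_eq_C_mul, map_mul]
          simp only [mp, MvPolynomial.map_C]
        rw [map_sub, sub_mul, map_sub, sub_eq_zero, mul_comm, h4,
          mul_comm (∑ i, algebraMap A K (c i) • mp (s i)), Finset.mul_sum, map_sum] at h3
        rw [h1, mul_smul_comm, map_smul, h3]
        simp [mul_smul_comm, hx']
    · intro hx
      apply (TensorProduct.piScalarRight A K K (Fin r)).injective
      funext i
      rw [hcomm, (mem_annRel _ _).mp hx]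
      simp
  -- dimension count
  let θ : MvPolynomial (Fin n) K →ₗ[K] K ⊗[A] (Fin r → A) := φK ∘ₗ e.symm.toLinearMap
  have hθker : LinearMap.ker θ = (annRel G).restrictScalars K := by
    ext x
    simp [θ, hker]
  have hθrange : LinearMap.range θ = LinearMap.range φK := by
    apply LinearMap.range_comp_of_range_eq_top
    exact LinearMap.range_eq_top.mpr e.symm.surjective
  have e1 : (MvPolynomial (Fin n) K ⧸ annRel G) ≃ₗ[K] LinearMap.range φK :=
    (Submodule.Quotient.restrictScalarsEquiv K (annRel G)).symm ≪≫ₗ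
      (Submodule.quotEquivOfEq _ _ hθker.symm) ≪≫ₗ θ.quotKerEquivRange ≪≫ₗ
      LinearEquiv.ofEq _ _ hθrange
  let ψ := (LinearMap.range φ).mkQ.baseChange K
  have hψ : Function.Surjective ψ := LinearMap.lTensor_surjective K (Submodule.mkQ_surjective _)
  have hex : LinearMap.ker ψ = LinearMap.range φK := by
    have : Function.Exact φ (LinearMap.range φ).mkQ := by
      rw [LinearMap.exact_iff, Submodule.ker_mkQ]
    have := lTensor_exact K this (Submodule.mkQ_surjective _)
    ext x
    exact this x
  have hdim := ψ.finrank_range_add_finrank_ker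
  rw [hex, LinearMap.range_eq_top.mpr hψ, finrank_top,
    (TensorProduct.piScalarRight A K K (Fin r)).finrank_eq] at hdim
  rw [e1.finrank_eq]
  simp at hdim
  omega

theorem flatly_embedded_of_constant_fibre_length
    {A : Type*} [CommRing A] [IsNoetherianRing A] [IsReduced A] {n : ℕ}
    (F : Module.Dual A (MvPolynomial (Fin n) A))
    (hfin : Module.Finite A (MvPolynomial (Fin n) A ⧸ annRel F))
    (hconst : ∃ d : ℕ, ∀ p : PrimeSpectrum A,
      Module.finrank (resField p)
        (MvPolynomial (Fin n) (resField p) ⧸ annRel (dualBC (resField p) F)) = d) :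
    Module.Flat A (Module.Dual A (MvPolynomial (Fin n) A) ⧸ SAF F) := by
  obtain ⟨d, hd⟩ := hconst
  obtain ⟨r, v, hv⟩ := Module.Finite.exists_fin (R := A) (M := MvPolynomial (Fin n) A ⧸ annRel F)
  choose s hsv using fun i => Ideal.Quotient.mk_surjective (v i)
  have hs : ∀ τ, ∃ c : Fin r → A, τ - ∑ i, c i • s i ∈ annRel F := by
    intro τ
    have : Ideal.Quotient.mk (annRel F) τ ∈ Submodule.span A (Set.range v) := by simp [hv]
    obtain ⟨c, hc⟩ := (Submodule.mem_span_range_iff_exists_fun A).mp this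
    refine ⟨c, ?_⟩
    rw [← Ideal.Quotient.eq_zero_iff_mem, map_sub, ← hc, sub_eq_zero, map_sum]
    refine Finset.sum_congr rfl fun i _ => ?_
    rw [← hsv]
    rfl
  set φ := evalFam s ∘ₗ actMap F with hφ
  have hproj : Module.Projective A ((Fin r → A) ⧸ LinearMap.range φ) := by
    refine projective_of_const _ (r - d) fun K _ _ => ?_
    refine finrank_of_resField _ (r - d) (fun p => ?_) K
    rw [finrank_coker F s hs, hd]
  obtain ⟨t, ht⟩ := Module.projective_lifting_property (LinearMap.range φ).mkQ LinearMap.id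
    (Submodule.mkQ_surjective _)
  let Q := (LinearMap.range t).comap (evalFam s)
  have hcompl : IsCompl (SAF F) Q := by
    constructor
    · rw [Submodule.disjoint_def]
      rintro _ ⟨σ, rfl⟩ ⟨c, hc⟩
      have h0 : c = 0 := by
        have h1 := LinearMap.congr_fun ht c
        rw [LinearMap.comp_apply, hc] at h1
        rw [← LinearMap.id_apply (R := A) c, ← h1, Submodule.mkQ_apply,
          Submodule.Quotient.mk_eq_zero]
        exact ⟨σ, rfl⟩
      rw [h0, map_zero] at hc
      have hc' : ∀ i, F (σ * s i) = 0 := fun i => (congrFun hc i).symm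
      change σ ∈ annRel F
      rw [mem_annRel]
      intro τ
      obtain ⟨a, ha⟩ := hs τ
      have h2 := (mem_annRel _ _).mp ha σ
      rw [mul_comm, mul_sub, map_sub, sub_eq_zero, Finset.mul_sum, map_sum] at h2
      rw [h2]
      simp [hc']
    · rw [codisjoint_iff, eq_top_iff]
      intro f _
      have h1 : evalFam s f - t ((LinearMap.range φ).mkQ (evalFam s f)) ∈ LinearMap.range φ := by
        rw [← Submodule.Quotient.mk_eq_zero, ← Submodule.mkQ_apply, map_sub]
        have := LinearMap.congr_fun ht ((LinearMap.range φ).mkQ (evalFam s f))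
        rw [LinearMap.comp_apply] at this
        rw [this]
        simp
      obtain ⟨σ, hσ⟩ := h1
      rw [Submodule.mem_sup]
      refine ⟨actMap F σ, ⟨σ, rfl⟩, f - actMap F σ, ?_, by abel⟩
      change evalFam s (f - actMap F σ) ∈ LinearMap.range t
      refine ⟨(LinearMap.range φ).mkQ (evalFam s f), ?_⟩
      rw [map_sub]
      change φ σ = _ at hσ
      have : evalFam s (actMap F σ) = φ σ := rfl
      rw [this, hσ]
      abel
  have hflat : Module.Flat A (Module.Dual A (MvPolynomial (Fin n) A)) := by
    have := flat_pi_self A (Fin n →₀ ℕ)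
    exact Module.Flat.of_linearEquiv ((MvPolynomial.basisMonomials (Fin n) A).constr A).symm
  have e := Submodule.quotientEquivOfIsCompl _ _ hcompl
  have : Module.Flat A Q := Module.Flat.of_retract Q.subtype
    (Submodule.projectionOnto Q (SAF F) hcompl.symm)
    (LinearMap.ext fun x => Submodule.projectionOnto_apply_left hcompl.symm x)
  exact Module.Flat.of_linearEquiv e

end RelativeApolarity
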